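/- (Proposition 2.1, first bijection.) The assignment (Δ, ε) ↦ L(Δ,ε) := {(v, ξ) ∈ V ⊕ V* : v ∈ Δ and ξ(w) = ε(v, w) for all w ∈ Δ} is a bijection from the set of pairs (Δ, ε), where Δ is a subspace of V and ε is an alternating bilinear form on Δ, onto the set of Lagrangian subspaces of V ⊕ V*. -/

import Mathlib

/-- The canonical split-signature pairing on `V ⊕ V*`. -/
noncomputable def diracPairing {V : Type*} [AddCommGroup V] [Module ℝ V]
    (x y : V × Module.Dual ℝ V) : ℝ :=
  (x.2 y.1 + y.2 x.1) / 2

/-- `L ⊆ V ⊕ V*` is Lagrangian: `dim L = dim V` and the pairing vanishes on `L`. -/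
def IsLagrangian {V : Type*} [AddCommGroup V] [Module ℝ V]
    (L : Submodule ℝ (V × Module.Dual ℝ V)) : Prop :=
  Module.finrank ℝ L = Module.finrank ℝ V ∧
    ∀ x ∈ L, ∀ y ∈ L, diracPairing x y = 0

/-- The underlying set of `L(Δ,ε) = {(v,ξ) : v ∈ Δ, ξ|_Δ = ε(v,·)}`. -/
def graphSet {V : Type*} [AddCommGroup V] [Module ℝ V]
    (p : (Δ : Submodule ℝ V) × {ε : Δ →ₗ[ℝ] Δ →ₗ[ℝ] ℝ // ∀ x, ε x x = 0}) :
    Set (V × Module.Dual ℝ V) :=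
  {q | ∃ h : q.1 ∈ p.1, ∀ w : p.1, q.2 w = p.2.1 ⟨q.1, h⟩ w}

/-- helper: the graph as a submodule. -/
def graphSub {V : Type*} [AddCommGroup V] [Module ℝ V]
    (p : (Δ : Submodule ℝ V) × {ε : Δ →ₗ[ℝ] Δ →ₗ[ℝ] ℝ // ∀ x, ε x x = 0}) :
    Submodule ℝ (V × Module.Dual ℝ V) where
  carrier := graphSet p
  zero_mem' := by
    refine ⟨p.1.zero_mem, fun w => ?_⟩
    have : (⟨(0 : V × Module.Dual ℝ V).1, p.1.zero_mem⟩ : p.1) = 0 := rfl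
    rw [this]; simp
  add_mem' := by
    rintro a b ⟨ha, ha'⟩ ⟨hb, hb'⟩
    refine ⟨p.1.add_mem ha hb, fun w => ?_⟩
    have : (⟨(a + b).1, p.1.add_mem ha hb⟩ : p.1) = ⟨a.1, ha⟩ + ⟨b.1, hb⟩ := rfl
    rw [this, map_add, LinearMap.add_apply, ← ha', ← hb']; rfl
  smul_mem' := by
    rintro c a ⟨ha, ha'⟩
    refine ⟨p.1.smul_mem c ha, fun w => ?_⟩
    have : (⟨(c • a).1, p.1.smul_mem c ha⟩ : p.1) = c • ⟨a.1, ha⟩ := rfl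
    rw [this, map_smul, LinearMap.smul_apply, ← ha']; rfl

theorem exists_ext_graph {V : Type*} [AddCommGroup V] [Module ℝ V]
    (p : (Δ : Submodule ℝ V) × {ε : Δ →ₗ[ℝ] Δ →ₗ[ℝ] ℝ // ∀ x, ε x x = 0}) :
    ∃ e : p.1 →ₗ[ℝ] Module.Dual ℝ V, ∀ v w : p.1, e v w = p.2.1 v w := by
  obtain ⟨P, hP⟩ := p.1.subtype.exists_leftInverse_of_injective p.1.ker_subtype
  refine ⟨(LinearMap.lcomp ℝ ℝ P).comp p.2.1, fun v w => ?_⟩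
  have : P w = w := LinearMap.congr_fun hP w
  simp [this]

theorem finrank_graphSub {V : Type*} [AddCommGroup V] [Module ℝ V] [FiniteDimensional ℝ V]
    (p : (Δ : Submodule ℝ V) × {ε : Δ →ₗ[ℝ] Δ →ₗ[ℝ] ℝ // ∀ x, ε x x = 0}) :
    Module.finrank ℝ (graphSub p) = Module.finrank ℝ V := by
  obtain ⟨e, he⟩ := exists_ext_graph p
  let f : (p.1 × p.1.dualAnnihilator) →ₗ[ℝ] V × Module.Dual ℝ V :=
    (p.1.subtype.comp (LinearMap.fst ℝ _ _)).prod
      (e.comp (LinearMap.fst ℝ _ _) + p.1.dualAnnihilator.subtype.comp (LinearMap.snd ℝ _ _))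
  have hf : ∀ x, f x = ((x.1 : V), e x.1 + (x.2 : Module.Dual ℝ V)) := fun x => rfl
  have hinj : Function.Injective f := by
    rintro ⟨a, b⟩ ⟨c, d⟩ h
    rw [hf, hf, Prod.mk.injEq] at h
    obtain ⟨h1, h2⟩ := h
    have h1' : a = c := Subtype.ext h1
    subst h1'
    have h3 : b = d := Subtype.ext (add_left_cancel h2)
    rw [h3]
  have hr : LinearMap.range f = graphSub p := by
    ext ⟨v, ξ⟩
    constructor
    · rintro ⟨⟨a, b⟩, h⟩
      rw [hf, Prod.mk.injEq] at h
      obtain ⟨h1, h2⟩ := h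
      dsimp only at h1 h2
      subst h1 h2
      refine ⟨a.2, fun w => ?_⟩
      have := (Submodule.mem_dualAnnihilator _).1 b.2 w w.2
      simp [he, this]
    · rintro ⟨h1, h2⟩
      dsimp only at h1 h2
      refine ⟨(⟨v, h1⟩, ⟨ξ - e ⟨v, h1⟩, ?_⟩), ?_⟩
      · rw [Submodule.mem_dualAnnihilator]
        intro w hw
        have a1 := h2 ⟨w, hw⟩
        have a2 := he ⟨v, h1⟩ ⟨w, hw⟩
        dsimp only at a1 a2
        rw [LinearMap.sub_apply, a1, a2, sub_self]
      · rw [hf]; simp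
  haveI : Module.Free ℝ p.1.dualAnnihilator := Module.Free.of_divisionRing ℝ p.1.dualAnnihilator
  haveI : Module.Finite ℝ p.1.dualAnnihilator := FiniteDimensional.finiteDimensional_submodule _
  rw [← hr, LinearMap.finrank_range_of_inj hinj, Module.finrank_prod]
  exact Subspace.finrank_add_finrank_dualAnnihilator_eq p.1

theorem alt_neg_graph {V : Type*} [AddCommGroup V] [Module ℝ V]
    (ε : V →ₗ[ℝ] V →ₗ[ℝ] ℝ) (h : ∀ x, ε x x = 0) (v w : V) : ε v w + ε w v = 0 := by
  have := h (v + w)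
  simp only [map_add, LinearMap.add_apply, h] at this
  linarith

theorem graphSub_lagrangian {V : Type*} [AddCommGroup V] [Module ℝ V] [FiniteDimensional ℝ V]
    (p : (Δ : Submodule ℝ V) × {ε : Δ →ₗ[ℝ] Δ →ₗ[ℝ] ℝ // ∀ x, ε x x = 0}) :
    IsLagrangian (graphSub p) := by
  refine ⟨finrank_graphSub p, ?_⟩
  rintro x ⟨hx, hx'⟩ y ⟨hy, hy'⟩
  have h1 := hx' ⟨y.1, hy⟩
  have h2 := hy' ⟨x.1, hx⟩
  dsimp only at h1 h2
  rw [diracPairing, h1, h2, alt_neg_graph p.2.1 p.2.2, zero_div]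

theorem graphSet_le {V : Type*} [AddCommGroup V] [Module ℝ V]
    {p q : (Δ : Submodule ℝ V) × {ε : Δ →ₗ[ℝ] Δ →ₗ[ℝ] ℝ // ∀ x, ε x x = 0}}
    (h : graphSet p = graphSet q) : p.1 ≤ q.1 := by
  intro v hv
  obtain ⟨e, he⟩ := exists_ext_graph p
  have : (v, e ⟨v, hv⟩) ∈ graphSet p := ⟨hv, fun w => he _ _⟩
  rw [h] at this
  exact this.1

theorem graphSet_inj {V : Type*} [AddCommGroup V] [Module ℝ V]
    {p q : (Δ : Submodule ℝ V) × {ε : Δ →ₗ[ℝ] Δ →ₗ[ℝ] ℝ // ∀ x, ε x x = 0}}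
    (h : graphSet p = graphSet q) : p = q := by
  have h1 : p.1 = q.1 := le_antisymm (graphSet_le h) (graphSet_le h.symm)
  obtain ⟨Δ, ε⟩ := p
  obtain ⟨Δ', ε'⟩ := q
  dsimp only at h1
  subst h1
  congr 1
  apply Subtype.ext
  ext v w
  obtain ⟨e, he⟩ := exists_ext_graph ⟨Δ, ε⟩
  have : ((v : V), e v) ∈ graphSet ⟨Δ, ε⟩ := ⟨v.2, fun w => he _ _⟩
  rw [h] at this
  obtain ⟨_, h3⟩ := this
  exact (he v w).symm.trans (h3 w)

/-- Proposition 2.1, first bijection: `(Δ, ε) ↦ L(Δ,ε)` is a bijection from pairs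
of a subspace `Δ ⊆ V` with an alternating bilinear form `ε` on `Δ`, onto the set
of Lagrangian subspaces of `V ⊕ V*`. -/
theorem lagrangian_classification_forms
    (V : Type*) [AddCommGroup V] [Module ℝ V] [FiniteDimensional ℝ V] :
    (∀ p : (Δ : Submodule ℝ V) × {ε : Δ →ₗ[ℝ] Δ →ₗ[ℝ] ℝ // ∀ x, ε x x = 0},
      ∃ L : Submodule ℝ (V × Module.Dual ℝ V),
        (L : Set (V × Module.Dual ℝ V)) = graphSet p ∧ IsLagrangian L) ∧
    (∀ L : Submodule ℝ (V × Module.Dual ℝ V), IsLagrangian L →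
      ∃! p : (Δ : Submodule ℝ V) × {ε : Δ →ₗ[ℝ] Δ →ₗ[ℝ] ℝ // ∀ x, ε x x = 0},
        (L : Set (V × Module.Dual ℝ V)) = graphSet p) := by
  refine ⟨fun p => ⟨graphSub p, rfl, graphSub_lagrangian p⟩, fun L hL => ?_⟩
  obtain ⟨hd, hp⟩ := hL
  have hp' : ∀ x ∈ L, ∀ y ∈ L, x.2 y.1 + y.2 x.1 = 0 := by
    intro x hx y hy
    have := hp x hx y hy
    unfold diracPairing at this
    linarith
  let π : L →ₗ[ℝ] V := (LinearMap.fst ℝ V (Module.Dual ℝ V)).comp L.subtype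
  obtain ⟨s, hs⟩ := π.rangeRestrict.exists_rightInverse_of_surjective π.range_rangeRestrict
  have hs' : ∀ v : LinearMap.range π, (s v).1.1 = v := fun v =>
    congrArg Subtype.val (LinearMap.congr_fun hs v)
  let ε : LinearMap.range π →ₗ[ℝ] LinearMap.range π →ₗ[ℝ] ℝ :=
    (LinearMap.lcomp ℝ ℝ (LinearMap.range π).subtype).comp
      (((LinearMap.snd ℝ V (Module.Dual ℝ V)).comp L.subtype).comp s)
  have hε : ∀ v w, ε v w = (s v).1.2 (w : V) := fun v w => rfl
  have halt : ∀ x, ε x x = 0 := by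
    intro x
    have := hp' _ (s x).2 _ (s x).2
    rw [hs'] at this
    rw [hε]
    linarith
  let p : (Δ : Submodule ℝ V) × {ε : Δ →ₗ[ℝ] Δ →ₗ[ℝ] ℝ // ∀ x, ε x x = 0} :=
    ⟨LinearMap.range π, ε, halt⟩
  have hle : L ≤ graphSub p := by
    intro x hx
    have hm : x.1 ∈ LinearMap.range π := ⟨⟨x, hx⟩, rfl⟩
    refine ⟨hm, fun (w : LinearMap.range π) => ?_⟩
    change x.2 w = ε ⟨x.1, hm⟩ w
    have h1 := hp' x hx _ (s w).2
    have h2 := hp' _ (s ⟨x.1, hm⟩).2 _ (s w).2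
    rw [hs'] at h1
    rw [hs', hs'] at h2
    rw [hε]
    linarith
  have heq : L = graphSub p :=
    Submodule.eq_of_le_of_finrank_eq hle (hd.trans (finrank_graphSub p).symm)
  have heq' : (L : Set (V × Module.Dual ℝ V)) = graphSet p := congrArg SetLike.coe heq
  exact ⟨p, heq', fun q hq => graphSet_inj (hq.symm.trans heq')⟩
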